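/- If P is an ordered set with a least element and P is the union of a chain of principal order ideals (that is, there is a family of principal ideals of P, totally ordered by inclusion, whose union is P), then there exists a lattice L such that P is order-isomorphic to the ordered set Princ L of principal congruences of L. -/

import Mathlib

/-- A lattice congruence: an equivalence relation compatible with meet and join. -/
def IsLatCon {L : Type*} [Lattice L] (r : L → L → Prop) : Prop :=
  Equivalence r ∧
  (∀ a b c d, r a b → r c d → r (a ⊓ c) (b ⊓ d)) ∧
  (∀ a b c d, r a b → r c d → r (a ⊔ c) (b ⊔ d))

/-- The principal congruence generated by the pair `(a, b)`:
the smallest congruence relating `a` and `b`. -/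
def cg {L : Type*} [Lattice L] (a b : L) (x y : L) : Prop :=
  ∀ r : L → L → Prop, IsLatCon r → r a b → r x y

/-- The ordered set of principal congruences of `L`, ordered by inclusion. -/
def Princ (L : Type*) [Lattice L] : Type _ :=
  {θ : L → L → Prop // ∃ a b : L, θ = cg a b}

instance (L : Type*) [Lattice L] : PartialOrder (Princ L) :=
  inferInstanceAs (PartialOrder {θ : L → L → Prop // ∃ a b : L, θ = cg a b})

universe u

/-- A Galois connection between a partial order and a chain of levels, under which every level
is attained: `c` embeds `E` as a cofinal chain and `d p` is the least level above `p`. -/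
structure LevelSystem (Q E : Type u) [PartialOrder Q] [LinearOrder E] where
  d : Q → E
  c : E → Q
  gc : ∀ p e, d p ≤ e ↔ p ≤ c e
  dc : ∀ e, d (c e) = e

/-- The elements of a lattice whose nonzero principal congruences are indexed by `Q`. Each level `e`
contributes an interval from `bot e` to `top e`; these intervals form an increasing family.
The pair `vx (F.d p) p` has the colour `p`; `fr` makes every level simple enough that collapsing
part of it next to `bot e` or `top e` gives the colour `F.c e`, `mu` forces `p` below `q`, and
`xl`, `xt` glue the levels. -/
inductive GadgetLattice {Q E : Type u} [PartialOrder Q] [LinearOrder E]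
    (F : LevelSystem Q E) : Type u
  | bot (e : E)
  | top (e : E)
  | vx (e : E) (p : Q) (k : Bool) (h : F.d p ≤ e)
  | fr (e : E) (i : Option Bool)
  | mu (p q : Q) (a b : Bool) (h : p < q) (hab : b = true → a = true)
  | xl (e : E) (p : Q) (k : Bool) (h : F.d p < e)
  | xt (e : E) (p : Q) (c : E) (h : F.d p ≤ c) (hc : c < e)

namespace GadgetLattice

variable {Q E : Type u} [PartialOrder Q] [LinearOrder E] {F : LevelSystem Q E}

/-- The level of an element. -/
def lev : GadgetLattice F → E
  | bot e => e
  | top e => e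
  | vx e _ _ _ => e
  | fr e _ => e
  | mu _ q _ _ _ _ => F.d q
  | xl e _ _ _ => e
  | xt e _ _ _ _ => e

/-- The part of `rel` in which the left argument, of level `e`, enters only through `top e` or
through the collapse of its level. -/
def outer (G : Q → Prop) (e : E) : GadgetLattice F → Prop
  | top e' => e ≤ e' ∨ G (F.c e)
  | xt _ _ c _ _ => e ≤ c ∨ G (F.c e)
  | xl _ p _ _ => G (F.c e) ∧ G (F.c (F.d p))
  | z => G (F.c e) ∧ G (F.c z.lev)

/-- The part of `rel` that depends on the fine structure of both arguments. -/
def inner (G : Q → Prop) : GadgetLattice F → GadgetLattice F → Prop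
  | bot _, top _ => True
  | bot _, xt _ _ _ _ _ => True
  | bot e, xl _ p _ _ => F.d p ≤ e ∨ G (F.c (F.d p))
  | bot e, z => z.lev ≤ e ∨ G (F.c z.lev)
  | vx e p k _, vx e' p' k' _ => e = e' ∧ p = p' ∧ (k = false ∨ k' = true ∨ G p)
  | vx e p k _, fr e' i => e = e' ∧ i = none ∧ p = F.c e ∧ k = false
  | vx e p k _, mu p' q' a b _ _ => e = F.d q' ∧
      ((p = p' ∧ (k = false ∨ a = true ∨ G p)) ∨ (p = q' ∧ (k = false ∨ b = true ∨ G p)))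
  | vx e p k _, xl e' p' k' _ =>
      p = p' ∧ (e = e' ∨ e = F.d p) ∧ (k = false ∨ k' = true ∨ G p)
  | vx e p _ _, xt e' p' _ _ _ => p = p' ∧ e = e'
  | fr e i, fr e' i' => e = e' ∧ i = i'
  | mu p q a b _ _, mu p' q' a' b' _ _ => p = p' ∧ q = q' ∧
      (a = false ∨ a' = true ∨ G p) ∧ (b = false ∨ b' = true ∨ G q)
  | xl e p k _, xl e' p' k' _ => e = e' ∧ p = p' ∧ (k = false ∨ k' = true ∨ G p)
  | xl e p _ _, xt e' p' _ _ _ => e = e' ∧ p = p'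
  | xt e p c _ _, xl e' p' _ _ => e = e' ∧ p = p' ∧ G (F.c c)
  | xt e p c _ _, xt e' p' c' _ _ => e = e' ∧ p = p' ∧ (c ≤ c' ∨ G (F.c c))
  | _, _ => False

/-- The quotient preorder of the gadget lattice after collapsing all colours in the lower set `G`;
for the empty `G` it is the order of the lattice. -/
def rel (G : Q → Prop) (x y : GadgetLattice F) : Prop := inner G x y ∨ outer G x.lev y

theorem low_mono {G : Q → Prop} (hG : ∀ p q, p ≤ q → G q → G p) {e e' : E} (h : e ≤ e')
    (h' : G (F.c e')) : G (F.c e) := by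
  refine hG _ _ ?_ h'
  rw [← F.gc, F.dc]; exact h

theorem low_of {G : Q → Prop} (hG : ∀ p q, p ≤ q → G q → G p) {p : Q}
    (h' : G (F.c (F.d p))) : G p := hG _ _ ((F.gc _ _).1 le_rfl) h'

theorem d_mono {p q : Q} (h : p ≤ q) : F.d p ≤ F.d q :=
  (F.gc _ _).2 (h.trans ((F.gc _ _).1 le_rfl))

theorem rel_refl (G : Q → Prop) (x : GadgetLattice F) : rel G x x := by
  cases x <;> simp [rel, inner, outer, lev] <;> grind

set_option maxHeartbeats 4000000 in
theorem rel_trans {G : Q → Prop} (hG : ∀ p q, p ≤ q → G q → G p) {x y z : GadgetLattice F}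
    (h : rel G x y) (h' : rel G y z) : rel G x z := by
  have lm : ∀ e e', e ≤ e' → G (F.c e') → G (F.c e) := fun e e' => low_mono hG
  have lo : ∀ p, G (F.c (F.d p)) → G p := fun p => low_of hG
  have dm : ∀ p q : Q, p < q → F.d p ≤ F.d q := fun p q h => d_mono h.le
  have dc := F.dc
  have hG' : ∀ p q, p < q → G q → G p := fun p q h => hG p q h.le
  cases x <;> cases y <;> cases z <;> simp only [rel, inner, outer, lev] at h h' ⊢ <;> grind

theorem le_antisymm_aux {x y : GadgetLattice F} (h : rel (fun _ => False) x y)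
    (h' : rel (fun _ => False) y x) : x = y := by
  have dm : ∀ p q : Q, p < q → F.d p ≤ F.d q := fun p q h => d_mono h.le
  have dc := F.dc
  cases x <;> cases y <;> simp only [rel, inner, outer, lev, or_false, false_and] at h h' <;> grind

instance : PartialOrder (GadgetLattice F) where
  le x y := rel (fun _ => False) x y
  le_refl x := rel_refl _ x
  le_trans _ _ _ h h' := rel_trans (fun _ _ _ h => h) h h'
  le_antisymm _ _ h h' := le_antisymm_aux h h'

theorem le_def (x y : GadgetLattice F) : x ≤ y ↔ rel (fun _ => False) x y := Iff.rfl

theorem rel_of_le (G : Q → Prop) {x y : GadgetLattice F} (h : x ≤ y) : rel G x y := by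
  rw [le_def] at h
  cases x <;> cases y <;> simp only [rel, inner, outer, lev, or_false, false_and] at h ⊢ <;> grind

/-- The elements `x` and `y` have a greatest lower bound. -/
def HasMeet (x y : GadgetLattice F) : Prop :=
  ∃ m, m ≤ x ∧ m ≤ y ∧ ∀ w, w ≤ x → w ≤ y → w ≤ m

theorem HasMeet.symm {x y : GadgetLattice F} : HasMeet x y → HasMeet y x :=
  fun ⟨m, h1, h2, h3⟩ => ⟨m, h2, h1, fun w a b => h3 w b a⟩

theorem hasMeet_of_le {x y : GadgetLattice F} (h : x ≤ y) : HasMeet x y :=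
  ⟨x, le_rfl, h, fun _ a _ => a⟩

theorem hasMeet_of {x y : GadgetLattice F} (m : GadgetLattice F) (h1 : m ≤ x) (h2 : m ≤ y)
    (hbot : ∀ e, bot e ≤ x → bot e ≤ y → bot e ≤ m)
    (htop : ∀ e, top e ≤ x → top e ≤ y → top e ≤ m)
    (hvx : ∀ e p k h, vx e p k h ≤ x → vx e p k h ≤ y → vx e p k h ≤ m)
    (hfr : ∀ e i, fr e i ≤ x → fr e i ≤ y → fr e i ≤ m)
    (hmu : ∀ p q a b h hab, mu p q a b h hab ≤ x → mu p q a b h hab ≤ y → mu p q a b h hab ≤ m)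
    (hxl : ∀ e p k h, xl e p k h ≤ x → xl e p k h ≤ y → xl e p k h ≤ m)
    (hxt : ∀ e p c h hc, xt e p c h hc ≤ x → xt e p c h hc ≤ y → xt e p c h hc ≤ m) :
    HasMeet x y :=
  ⟨m, h1, h2, fun w => by
    cases w
    exacts [hbot _, htop _, hvx _ _ _ _, hfr _ _, hmu _ _ _ _ _ _, hxl _ _ _ _, hxt _ _ _ _ _]⟩

theorem hasMeet_bot (e : E) (y : GadgetLattice F) : HasMeet (bot e) y := by
  have dm : ∀ p q : Q, p < q → F.d p ≤ F.d q := fun p q h => d_mono h.le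
  have dc := F.dc
  rcases y with e' | e' | ⟨e', p, k, h⟩ | ⟨e', i⟩ | ⟨p, q, a, b, h, hab⟩ | ⟨e', p, k, h⟩ |
    ⟨e', p, c, h, hc⟩
  case top => exact hasMeet_of_le (by simp [le_def, rel, inner, outer, lev])
  case xt => exact hasMeet_of_le (by simp [le_def, rel, inner, outer, lev])
  case bot => apply hasMeet_of (bot (max e e')) <;> simp [le_def, rel, inner, outer, lev] <;> grind
  case vx => apply hasMeet_of (bot (max e e')) <;> simp [le_def, rel, inner, outer, lev] <;> grind
  case fr => apply hasMeet_of (bot (max e e')) <;> simp [le_def, rel, inner, outer, lev] <;> grind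
  case mu => apply hasMeet_of (bot (max e (F.d q))) <;>
    simp [le_def, rel, inner, outer, lev] <;> grind
  case xl => apply hasMeet_of (bot (max e (F.d p))) <;>
    simp [le_def, rel, inner, outer, lev] <;> grind

theorem hasMeet_top (e : E) (y : GadgetLattice F) : HasMeet (top e) y := by
  have dm : ∀ p q : Q, p < q → F.d p ≤ F.d q := fun p q h => d_mono h.le
  have dc := F.dc
  rcases y with e' | e' | ⟨e', p, k, h⟩ | ⟨e', i⟩ | ⟨p, q, a, b, h, hab⟩ | ⟨e', p, k, h⟩ |
    ⟨e', p, c, h, hc⟩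
  case bot => exact (hasMeet_bot _ _).symm
  case top => apply hasMeet_of (top (min e e')) <;> simp [le_def, rel, inner, outer, lev] <;> grind
  case vx =>
    rcases le_or_gt e' e with h' | h'
    · exact (hasMeet_of_le (by simp [le_def, rel, inner, outer, lev]; exact h')).symm
    · apply hasMeet_of (bot e') <;> simp [le_def, rel, inner, outer, lev] <;> grind
  case fr =>
    rcases le_or_gt e' e with h' | h'
    · exact (hasMeet_of_le (by simp [le_def, rel, inner, outer, lev]; exact h')).symm
    · apply hasMeet_of (bot e') <;> simp [le_def, rel, inner, outer, lev] <;> grind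
  case mu =>
    rcases le_or_gt (F.d q) e with h' | h'
    · exact (hasMeet_of_le (by simp [le_def, rel, inner, outer, lev]; exact h')).symm
    · apply hasMeet_of (bot (F.d q)) <;> simp [le_def, rel, inner, outer, lev] <;> grind
  case xl =>
    rcases le_or_gt e' e with h' | h'
    · exact (hasMeet_of_le (by simp [le_def, rel, inner, outer, lev]; exact h')).symm
    · rcases le_or_gt (F.d p) e with h'' | h''
      · apply hasMeet_of (vx (F.d p) p k le_rfl) <;> simp [le_def, rel, inner, outer, lev] <;> grind
      · apply hasMeet_of (bot (F.d p)) <;> simp [le_def, rel, inner, outer, lev] <;> grind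
  case xt =>
    rcases le_or_gt e' e with h' | h'
    · exact (hasMeet_of_le (by simp [le_def, rel, inner, outer, lev]; exact h')).symm
    · apply hasMeet_of (top (min e c)) <;> simp [le_def, rel, inner, outer, lev] <;> grind

set_option maxHeartbeats 1000000 in
theorem hasMeet_vx (e : E) (p : Q) (k : Bool) (h : F.d p ≤ e) (y : GadgetLattice F) :
    HasMeet (vx e p k h) y := by
  have dm : ∀ p q : Q, p < q → F.d p ≤ F.d q := fun p q h => d_mono h.le
  have dc := F.dc
  rcases y with e' | e' | ⟨e', p', k', h'⟩ | ⟨e', i⟩ | ⟨p', q', a, b, h', hab⟩ | ⟨e', p', k', h'⟩ |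
    ⟨e', p', c, h', hc⟩
  case bot => exact (hasMeet_bot _ _).symm
  case top => exact (hasMeet_top _ _).symm
  case vx =>
    by_cases hp : e = e' ∧ p = p'
    · apply hasMeet_of (vx e p (k && k') h) <;> simp [le_def, rel, inner, outer, lev] <;> grind
    · apply hasMeet_of (bot (max e e')) <;> simp [le_def, rel, inner, outer, lev] <;> grind
  case fr =>
    by_cases hp : e = e' ∧ p = F.c e ∧ i = none
    · apply hasMeet_of (vx e p false h) <;> simp [le_def, rel, inner, outer, lev] <;> grind
    · apply hasMeet_of (bot (max e e')) <;> simp [le_def, rel, inner, outer, lev] <;> grind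
  case mu =>
    by_cases hp : e = F.d q' ∧ p = p'
    · apply hasMeet_of (vx e p (k && a) h) <;> simp [le_def, rel, inner, outer, lev] <;> grind
    · by_cases hp' : e = F.d q' ∧ p = q'
      · apply hasMeet_of (vx e p (k && b) h) <;> simp [le_def, rel, inner, outer, lev] <;> grind
      · apply hasMeet_of (bot (max e (F.d q'))) <;> simp [le_def, rel, inner, outer, lev] <;> grind
  case xl =>
    by_cases hp : p = p' ∧ (e = e' ∨ e = F.d p)
    · apply hasMeet_of (vx e p (k && k') h) <;> simp [le_def, rel, inner, outer, lev] <;> grind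
    · apply hasMeet_of (bot (max e (F.d p'))) <;> simp [le_def, rel, inner, outer, lev] <;> grind
  case xt =>
    by_cases hp : (e = e' ∧ p = p') ∨ e ≤ c
    · apply hasMeet_of (vx e p k h) <;> simp [le_def, rel, inner, outer, lev] <;> grind
    · apply hasMeet_of (bot e) <;> simp [le_def, rel, inner, outer, lev] <;> grind

set_option maxHeartbeats 1000000 in
theorem hasMeet_fr (e : E) (i : Option Bool) (y : GadgetLattice F) :
    HasMeet (fr e i) y := by
  have dm : ∀ p q : Q, p < q → F.d p ≤ F.d q := fun p q h => d_mono h.le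
  have dc := F.dc
  rcases y with e' | e' | ⟨e', p', k', h'⟩ | ⟨e', i'⟩ | ⟨p', q', a, b, h', hab⟩ | ⟨e', p', k', h'⟩ |
    ⟨e', p', c, h', hc⟩
  case bot => exact (hasMeet_bot _ _).symm
  case top => exact (hasMeet_top _ _).symm
  case vx => exact (hasMeet_vx _ _ _ _ _).symm
  case fr =>
    by_cases hp : e = e' ∧ i = i'
    · exact hasMeet_of_le (by rw [hp.1, hp.2])
    · apply hasMeet_of (bot (max e e')) <;> simp [le_def, rel, inner, outer, lev] <;> grind
  case mu =>
    have gq : q' ≤ F.c (F.d q') := (F.gc _ _).1 le_rfl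
    by_cases hp : e = F.d q' ∧ i = none ∧ q' = F.c e
    · apply hasMeet_of (vx e (F.c e) false (dc e).le) <;>
        simp [le_def, rel, inner, outer, lev] <;> grind
    · apply hasMeet_of (bot (max e (F.d q'))) <;> simp [le_def, rel, inner, outer, lev] <;> grind
  case xl =>
    by_cases hp : e = F.d p' ∧ i = none ∧ p' = F.c e
    · apply hasMeet_of (vx e (F.c e) false (dc e).le) <;>
        simp [le_def, rel, inner, outer, lev] <;> grind
    · apply hasMeet_of (bot (max e (F.d p'))) <;> simp [le_def, rel, inner, outer, lev] <;> grind
  case xt =>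
    by_cases hp : e ≤ c
    · exact hasMeet_of_le (by simp [le_def, rel, inner, outer, lev]; grind)
    · by_cases hp' : e = e' ∧ i = none ∧ p' = F.c e
      · apply hasMeet_of (vx e (F.c e) false (dc e).le) <;>
          simp [le_def, rel, inner, outer, lev] <;> grind
      · apply hasMeet_of (bot e) <;> simp [le_def, rel, inner, outer, lev] <;> grind

set_option maxHeartbeats 1000000 in
theorem hasMeet_mu (p q : Q) (a b : Bool) (h : p < q) (hab : b = true → a = true)
    (y : GadgetLattice F) : HasMeet (mu p q a b h hab) y := by
  have dm : ∀ p q : Q, p < q → F.d p ≤ F.d q := fun p q h => d_mono h.le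
  have dc := F.dc
  rcases y with e' | e' | ⟨e', p', k', h'⟩ | ⟨e', i'⟩ | ⟨p', q', a', b', h', hab'⟩ |
    ⟨e', p', k', h'⟩ | ⟨e', p', c, h', hc⟩
  case bot => exact (hasMeet_bot _ _).symm
  case top => exact (hasMeet_top _ _).symm
  case vx => exact (hasMeet_vx _ _ _ _ _).symm
  case fr => exact (hasMeet_fr _ _ _).symm
  case mu =>
    by_cases hp : p = p' ∧ q = q'
    · apply hasMeet_of (mu p q (a && a') (b && b') h (by grind)) <;>
        simp [le_def, rel, inner, outer, lev] <;> grind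
    · by_cases hd : F.d q = F.d q'
      · by_cases h1 : p = p'
        · apply hasMeet_of (vx (F.d q) p (a && a') (dm p q h)) <;>
            simp [le_def, rel, inner, outer, lev] <;> grind
        by_cases h2 : p = q'
        · apply hasMeet_of (vx (F.d q) p (a && b') (dm p q h)) <;>
            simp [le_def, rel, inner, outer, lev] <;> grind
        by_cases h3 : q = p'
        · apply hasMeet_of (vx (F.d q) q (b && a') le_rfl) <;>
            simp [le_def, rel, inner, outer, lev] <;> grind
        by_cases h4 : q = q'
        · apply hasMeet_of (vx (F.d q) q (b && b') le_rfl) <;>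
            simp [le_def, rel, inner, outer, lev] <;> grind
        apply hasMeet_of (bot (F.d q)) <;> simp [le_def, rel, inner, outer, lev] <;> grind
      · apply hasMeet_of (bot (max (F.d q) (F.d q'))) <;>
          simp [le_def, rel, inner, outer, lev] <;> grind
  case xl =>
    by_cases h1 : p = p' ∧ (F.d q = e' ∨ F.d q = F.d p')
    · apply hasMeet_of (vx (F.d q) p (a && k') (dm p q h)) <;>
        simp [le_def, rel, inner, outer, lev] <;> grind
    by_cases h2 : q = p'
    · apply hasMeet_of (vx (F.d q) q (b && k') le_rfl) <;>
        simp [le_def, rel, inner, outer, lev] <;> grind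
    apply hasMeet_of (bot (max (F.d q) (F.d p'))) <;>
      simp [le_def, rel, inner, outer, lev] <;> grind
  case xt =>
    by_cases hp : F.d q ≤ c
    · exact hasMeet_of_le (by simp [le_def, rel, inner, outer, lev]; grind)
    by_cases h1 : p = p' ∧ F.d q = e'
    · apply hasMeet_of (vx (F.d q) p a (dm p q h)) <;>
        simp [le_def, rel, inner, outer, lev] <;> grind
    · apply hasMeet_of (bot (F.d q)) <;> simp [le_def, rel, inner, outer, lev] <;> grind

set_option maxHeartbeats 1000000 in
theorem hasMeet_xl (e : E) (p : Q) (k : Bool) (h : F.d p < e) (y : GadgetLattice F) :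
    HasMeet (xl e p k h) y := by
  have dm : ∀ p q : Q, p < q → F.d p ≤ F.d q := fun p q h => d_mono h.le
  have dc := F.dc
  rcases y with e' | e' | ⟨e', p', k', h'⟩ | ⟨e', i'⟩ | ⟨p', q', a', b', h', hab'⟩ |
    ⟨e', p', k', h'⟩ | ⟨e', p', c, h', hc⟩
  case bot => exact (hasMeet_bot _ _).symm
  case top => exact (hasMeet_top _ _).symm
  case vx => exact (hasMeet_vx _ _ _ _ _).symm
  case fr => exact (hasMeet_fr _ _ _).symm
  case mu => exact (hasMeet_mu _ _ _ _ _ _ _).symm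
  case xl =>
    by_cases hp : p = p'
    · by_cases he : e = e'
      · apply hasMeet_of (xl e p (k && k') h) <;> simp [le_def, rel, inner, outer, lev] <;> grind
      · apply hasMeet_of (vx (F.d p) p (k && k') le_rfl) <;>
          simp [le_def, rel, inner, outer, lev] <;> grind
    · apply hasMeet_of (bot (max (F.d p) (F.d p'))) <;>
        simp [le_def, rel, inner, outer, lev] <;> grind
  case xt =>
    by_cases hp : (e = e' ∧ p = p') ∨ e ≤ c
    · exact hasMeet_of_le (by simp [le_def, rel, inner, outer, lev]; grind)
    by_cases hd : F.d p ≤ c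
    · apply hasMeet_of (vx (F.d p) p k le_rfl) <;> simp [le_def, rel, inner, outer, lev] <;> grind
    · apply hasMeet_of (bot (F.d p)) <;> simp [le_def, rel, inner, outer, lev] <;> grind

set_option maxHeartbeats 1000000 in
theorem hasMeet_xt (e : E) (p : Q) (c : E) (h : F.d p ≤ c) (hc : c < e) (y : GadgetLattice F) :
    HasMeet (xt e p c h hc) y := by
  have dm : ∀ p q : Q, p < q → F.d p ≤ F.d q := fun p q h => d_mono h.le
  have dc := F.dc
  rcases y with e' | e' | ⟨e', p', k', h'⟩ | ⟨e', i'⟩ | ⟨p', q', a', b', h', hab'⟩ |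
    ⟨e', p', k', h'⟩ | ⟨e', p', c', h', hc'⟩
  case bot => exact (hasMeet_bot _ _).symm
  case top => exact (hasMeet_top _ _).symm
  case vx => exact (hasMeet_vx _ _ _ _ _).symm
  case fr => exact (hasMeet_fr _ _ _).symm
  case mu => exact (hasMeet_mu _ _ _ _ _ _ _).symm
  case xl => exact (hasMeet_xl _ _ _ _ _).symm
  case xt =>
    by_cases hp : e = e' ∧ p = p'
    · apply hasMeet_of (xt e p (min c c') (by grind) (by grind)) <;>
        simp [le_def, rel, inner, outer, lev] <;> grind
    by_cases h1 : e ≤ c'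
    · exact hasMeet_of_le (by simp [le_def, rel, inner, outer, lev]; grind)
    by_cases h2 : e' ≤ c
    · exact (hasMeet_of_le (by simp [le_def, rel, inner, outer, lev]; grind)).symm
    apply hasMeet_of (top (min c c')) <;> simp [le_def, rel, inner, outer, lev] <;> grind

theorem hasMeet (x y : GadgetLattice F) : HasMeet x y := by
  cases x
  exacts [hasMeet_bot _ _, hasMeet_top _ _, hasMeet_vx _ _ _ _ _, hasMeet_fr _ _ _,
    hasMeet_mu _ _ _ _ _ _ _, hasMeet_xl _ _ _ _ _, hasMeet_xt _ _ _ _ _ _]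

/-- A strictly monotone rank away from the elements `bot e`. -/
def rank : GadgetLattice F → E ×ₗ (ℕ ×ₗ E)
  | bot e => toLex (e, toLex (0, e))
  | top e => toLex (e, toLex (9, e))
  | vx e _ k _ => toLex (e, toLex (1 + k.toNat, e))
  | fr e _ => toLex (e, toLex (3, e))
  | mu _ q a b _ _ => toLex (F.d q, toLex (3 + a.toNat + b.toNat, F.d q))
  | xl e _ k _ => toLex (e, toLex (3 + k.toNat, e))
  | xt e _ c _ _ => toLex (e, toLex (6, c))

set_option maxHeartbeats 1000000 in
theorem rank_lt {x y : GadgetLattice F} (h : x < y) (hx : ∀ e, x ≠ bot e) : rank x < rank y := by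
  have dm : ∀ p q : Q, p < q → F.d p ≤ F.d q := fun p q h => d_mono h.le
  have hbt : ∀ b : Bool, b.toNat ≤ 1 := Bool.toNat_le
  have hbf : false.toNat = 0 := rfl
  have hbs : true.toNat = 1 := rfl
  have hbz : ∀ b : Bool, b.toNat = 0 → b = false := by decide
  have hbo : ∀ b : Bool, b.toNat = 1 → b = true := by decide
  obtain ⟨h, hne⟩ := lt_iff_le_and_ne.1 h
  cases x <;> cases y <;> simp only [rank, Prod.Lex.toLex_lt_toLex] <;>
    revert h <;> simp [le_def, rel, inner, outer, lev] <;> grind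

theorem comparable_of_le_bot {x y : GadgetLattice F} {e : E} (h : x ≤ bot e) (h' : y ≤ bot e) :
    x ≤ y ∨ y ≤ x := by
  have := le_total (α := E)
  revert h h'
  cases x <;> cases y <;> simp [le_def, rel, inner, outer, lev] <;> grind

theorem le_top_lev (x : GadgetLattice F) {e : E} (h : x.lev ≤ e) : x ≤ top e := by
  revert h
  cases x <;> simp [le_def, rel, inner, outer, lev]

theorem exists_join [WellFoundedLT E] (x y : GadgetLattice F) :
    ∃ m, x ≤ m ∧ y ≤ m ∧ ∀ w, x ≤ w → y ≤ w → m ≤ w := by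
  by_cases hc : x ≤ y ∨ y ≤ x
  · rcases hc with hc | hc
    · exact ⟨y, hc, le_rfl, fun _ _ h => h⟩
    · exact ⟨x, le_rfl, hc, fun _ h _ => h⟩
  let U : Set (GadgetLattice F) := {w | x ≤ w ∧ y ≤ w}
  have hU : U.Nonempty := ⟨top (max x.lev y.lev), le_top_lev _ (le_max_left _ _),
    le_top_lev _ (le_max_right _ _)⟩
  have wf : WellFounded (fun a b : GadgetLattice F => rank a < rank b) :=
    InvImage.wf rank wellFounded_lt
  obtain ⟨m, hm, hmin⟩ := wf.has_min U hU
  refine ⟨m, hm.1, hm.2, fun w hx hy => ?_⟩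
  obtain ⟨v, hvm, hvw, hv⟩ := hasMeet m w
  have hvU : v ∈ U := ⟨hv _ hm.1 hx, hv _ hm.2 hy⟩
  rcases hvm.eq_or_lt with rfl | hlt
  · exact hvw
  · refine absurd (rank_lt hlt fun e he => hc ?_) (hmin v hvU)
    exact comparable_of_le_bot (e := e) (he ▸ hvU.1) (he ▸ hvU.2)

noncomputable instance [WellFoundedLT E] : Lattice (GadgetLattice F) where
  inf x y := (hasMeet x y).choose
  inf_le_left x y := (hasMeet x y).choose_spec.1
  inf_le_right x y := (hasMeet x y).choose_spec.2.1
  le_inf x y z h h' := (hasMeet y z).choose_spec.2.2 x h h'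
  sup x y := (exists_join x y).choose
  le_sup_left x y := (exists_join x y).choose_spec.1
  le_sup_right x y := (exists_join x y).choose_spec.2.1
  sup_le x y z h h' := (exists_join x y).choose_spec.2.2 z h h'

/-- The congruence collapsing exactly the colours in the lower set `G`. -/
def con (G : Q → Prop) (x y : GadgetLattice F) : Prop := rel G x y ∧ rel G y x

open Classical in
/-- A representative of the class of an element modulo `con G` lying above all the elements of this
class that are bounded by `K`. -/
noncomputable def expand (G : Q → Prop) (K : E) : GadgetLattice F → GadgetLattice F
  | bot e => if G (F.c e) then top (max e K) else bot e
  | top e => if G (F.c e) then top (max e K) else top e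
  | vx e p k h => if G (F.c e) then top (max e K) else vx e p (k || decide (G p)) h
  | fr e i => if G (F.c e) then top (max e K) else fr e i
  | mu p q a b h hab => if G (F.c (F.d q)) then top (max (F.d q) K) else
      if G q then mu p q true true h (fun _ => rfl) else
      if G p then mu p q true b h (fun _ => rfl) else mu p q a b h hab
  | xl e p k h => if G (F.c e) then top (max e K) else
      if h' : G (F.c (F.d p)) ∧ max (F.d p) K < e then
        xt e p (max (F.d p) K) (le_max_left _ _) h'.2 else
      xl e p (k || decide (G p)) h
  | xt e p c h hc => if G (F.c e) then top (max e K) else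
      if h' : G (F.c c) ∧ max c K < e then
        xt e p (max c K) (h.trans (le_max_left _ _)) h'.2 else
      xt e p c h hc

open Classical in
/-- A representative of the class of an element modulo `con G` lying below all the elements of this
class that are bounded by `K`. -/
noncomputable def shrink (G : Q → Prop) (K : E) : GadgetLattice F → GadgetLattice F
  | bot e => if G (F.c e) then bot (max e K) else bot e
  | top e => if G (F.c e) then bot (max e K) else top e
  | vx e p k h => if G (F.c e) then bot (max e K) else vx e p (k && !decide (G p)) h
  | fr e i => if G (F.c e) then bot (max e K) else fr e i
  | mu p q a b h hab => if G (F.c (F.d q)) then bot (max (F.d q) K) else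
      if G q then mu p q false false h (fun h => h) else
      if G p then mu p q b b h (fun h => h) else mu p q a b h hab
  | xl e p k h => if G (F.c e) then bot (max e K) else xl e p (k && !decide (G p)) h
  | xt e p c h hc => if G (F.c e) then bot (max e K) else
      if G (F.c c) then xl e p false (h.trans_lt hc) else xt e p c h hc

/-- The secondary level of an element. -/
def param : GadgetLattice F → E
  | xl _ p _ _ => F.d p
  | xt _ _ c _ _ => c
  | z => z.lev

/-- The collapsed levels occurring in `x` are at most `K`. -/
structure Bounds (G : Q → Prop) (F : LevelSystem Q E) (K : E) (x : GadgetLattice F) : Prop where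
  lev : G (F.c x.lev) → x.lev ≤ K
  param : G (F.c x.param) → x.param ≤ K

theorem exists_bound (G : Q → Prop) (F : LevelSystem Q E) (x y : GadgetLattice F) :
    ∃ K, (∀ e, G (F.c e) → G (F.c K)) ∧ Bounds G F K x ∧ Bounds G F K y := by
  have ext : ∀ K, (∀ e, G (F.c e) → G (F.c K)) → ∀ a : E, ∃ K', K ≤ K' ∧
      (∀ e, G (F.c e) → G (F.c K')) ∧ (G (F.c a) → a ≤ K') := by
    intro K hK a
    by_cases ha : G (F.c a)
    · refine ⟨max K a, le_max_left _ _, fun e he => ?_, fun _ => le_max_right _ _⟩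
      rcases max_choice K a with h | h <;> rw [h]
      exacts [hK _ he, ha]
    · exact ⟨K, le_rfl, hK, fun h => absurd h ha⟩
  obtain ⟨K, hK⟩ : ∃ K, ∀ e, G (F.c e) → G (F.c K) := by
    by_cases h : ∃ e, G (F.c e)
    · exact h.imp fun K hK _ _ => hK
    · exact ⟨x.lev, fun e he => absurd ⟨e, he⟩ h⟩
  obtain ⟨K1, l1, h1, b1⟩ := ext K hK x.lev
  obtain ⟨K2, l2, h2, b2⟩ := ext K1 h1 x.param
  obtain ⟨K3, l3, h3, b3⟩ := ext K2 h2 y.lev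
  obtain ⟨K4, l4, h4, b4⟩ := ext K3 h3 y.param
  exact ⟨K4, h4, ⟨fun h => (b1 h).trans (l2.trans (l3.trans l4)),
    fun h => (b2 h).trans (l3.trans l4)⟩, ⟨fun h => (b3 h).trans l4, b4⟩⟩

section

variable {G : Q → Prop} (hG : ∀ p q, p ≤ q → G q → G p) {K : E}

include hG

theorem rel_expand (hK : ∀ e, G (F.c e) → G (F.c K)) (y : GadgetLattice F) :
    rel G (expand G K y) y := by
  have lm : ∀ e e', e ≤ e' → G (F.c e') → G (F.c e) := fun e e' => low_mono hG
  have lo : ∀ p, G (F.c (F.d p)) → G p := fun p => low_of hG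
  have dm : ∀ p q : Q, p < q → F.d p ≤ F.d q := fun p q h => d_mono h.le
  have hG' : ∀ p q, p < q → G q → G p := fun p q h => hG p q h.le
  have hmax : ∀ a : E, G (F.c a) → G (F.c (max a K)) := fun a ha => by
    rcases max_choice a K with h | h <;> rw [h]
    exacts [ha, hK _ ha]
  cases y <;> simp only [expand] <;> split_ifs <;> simp [le_def, rel, inner, outer, lev] <;> grind

theorem shrink_rel (hK : ∀ e, G (F.c e) → G (F.c K)) (y : GadgetLattice F) :
    rel G y (shrink G K y) := by
  have lm : ∀ e e', e ≤ e' → G (F.c e') → G (F.c e) := fun e e' => low_mono hG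
  have lo : ∀ p, G (F.c (F.d p)) → G p := fun p => low_of hG
  have dm : ∀ p q : Q, p < q → F.d p ≤ F.d q := fun p q h => d_mono h.le
  have hG' : ∀ p q, p < q → G q → G p := fun p q h => hG p q h.le
  have hmax : ∀ a : E, G (F.c a) → G (F.c (max a K)) := fun a ha => by
    rcases max_choice a K with h | h <;> rw [h]
    exacts [ha, hK _ ha]
  cases y <;> simp only [shrink] <;> split_ifs <;> simp [le_def, rel, inner, outer, lev] <;> grind

set_option maxHeartbeats 1000000 in
theorem le_expand (hK : ∀ e, G (F.c e) → G (F.c K)) {x y : GadgetLattice F}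
    (hx : Bounds G F K x) (h : rel G x y) : x ≤ expand G K y := by
  have lm : ∀ e e', e ≤ e' → G (F.c e') → G (F.c e) := fun e e' => low_mono hG
  have lo : ∀ p, G (F.c (F.d p)) → G p := fun p => low_of hG
  have dm : ∀ p q : Q, p < q → F.d p ≤ F.d q := fun p q h => d_mono h.le
  have hG' : ∀ p q, p < q → G q → G p := fun p q h => hG p q h.le
  have dc := F.dc
  obtain ⟨h1, h2⟩ := hx
  cases y <;> simp only [expand] <;> split_ifs <;> cases x <;> simp only [param, lev] at h1 h2 <;>
    revert h <;> simp [le_def, rel, inner, outer, lev] <;> grind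

set_option maxHeartbeats 1000000 in
theorem shrink_le (hK : ∀ e, G (F.c e) → G (F.c K)) {x y : GadgetLattice F}
    (hx : Bounds G F K x) (h : rel G y x) : shrink G K y ≤ x := by
  have lm : ∀ e e', e ≤ e' → G (F.c e') → G (F.c e) := fun e e' => low_mono hG
  have lo : ∀ p, G (F.c (F.d p)) → G p := fun p => low_of hG
  have dm : ∀ p q : Q, p < q → F.d p ≤ F.d q := fun p q h => d_mono h.le
  have hG' : ∀ p q, p < q → G q → G p := fun p q h => hG p q h.le
  have dc := F.dc
  obtain ⟨h1, h2⟩ := hx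
  cases y <;> simp only [shrink] <;> split_ifs <;> cases x <;> simp only [param, lev] at h1 h2 <;>
    revert h <;> simp [le_def, rel, inner, outer, lev] <;> grind

end

theorem isLatCon_con [WellFoundedLT E] {G : Q → Prop} (hG : ∀ p q, p ≤ q → G q → G p) :
    IsLatCon (con (F := F) G) := by
  have up : ∀ {a b c d : GadgetLattice F}, rel G a b → rel G c d → rel G (a ⊔ c) (b ⊔ d) := by
    intro a b c d h h'
    obtain ⟨K, hK, ha, hc⟩ := exists_bound G F a c
    have h1 := le_expand hG hK ha (rel_trans hG h (rel_of_le G (le_sup_left (a := b) (b := d))))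
    have h2 := le_expand hG hK hc (rel_trans hG h' (rel_of_le G (le_sup_right (a := b) (b := d))))
    exact rel_trans hG (rel_of_le G (sup_le h1 h2)) (rel_expand hG hK _)
  have dn : ∀ {a b c d : GadgetLattice F}, rel G a b → rel G c d → rel G (a ⊓ c) (b ⊓ d) := by
    intro a b c d h h'
    obtain ⟨K, hK, ha, hc⟩ := exists_bound G F b d
    have h1 := shrink_le hG hK ha (rel_trans hG (rel_of_le G (inf_le_left (a := a) (b := c))) h)
    have h2 := shrink_le hG hK hc (rel_trans hG (rel_of_le G (inf_le_right (a := a) (b := c))) h')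
    exact rel_trans hG (shrink_rel hG hK _) (rel_of_le G (le_inf h1 h2))
  refine ⟨⟨fun x => ⟨rel_refl _ _, rel_refl _ _⟩, fun h => ⟨h.2, h.1⟩,
    fun h h' => ⟨rel_trans hG h.1 h'.1, rel_trans hG h'.2 h.2⟩⟩, ?_, ?_⟩
  · exact fun a b c d h h' => ⟨dn h.1 h'.1, dn h.2 h'.2⟩
  · exact fun a b c d h h' => ⟨up h.1 h'.1, up h.2 h'.2⟩

end GadgetLattice

theorem IsLatCon.convex {L : Type*} [Lattice L] {r : L → L → Prop} (hr : IsLatCon r)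
    {a b u v : L} (h : r a b) (hu : a ≤ u) (huv : u ≤ v) (hv : v ≤ b) : r u v := by
  have h1 := hr.2.1 _ _ _ _ (hr.2.2 _ _ _ _ h (hr.1.refl u)) (hr.1.refl v)
  rwa [sup_eq_right.2 hu, sup_eq_left.2 (huv.trans hv), inf_eq_left.2 huv, inf_eq_right.2 hv] at h1

theorem IsLatCon.down {L : Type*} [Lattice L] {r : L → L → Prop} (hr : IsLatCon r)
    {a b u v : L} (h : r a b) (hv : v ≤ b) (huv : u ≤ v) (hw : ∀ w, w ≤ a → w ≤ v → w ≤ u) :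
    r u v := by
  have h1 := hr.2.1 _ _ _ _ h (hr.1.refl v)
  rw [inf_eq_right.2 hv] at h1
  exact hr.convex h1 (hw _ inf_le_left inf_le_right) huv le_rfl

theorem IsLatCon.up {L : Type*} [Lattice L] {r : L → L → Prop} (hr : IsLatCon r)
    {a b u v : L} (h : r a b) (hu : a ≤ u) (huv : u ≤ v) (hw : ∀ w, b ≤ w → u ≤ w → v ≤ w) :
    r u v := by
  have h1 := hr.2.2 _ _ _ _ h (hr.1.refl u)
  rw [sup_eq_right.2 hu] at h1
  exact hr.convex h1 le_rfl huv (hw _ le_sup_left le_sup_right)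

namespace GadgetLattice

variable {Q E : Type u} [PartialOrder Q] [LinearOrder E] {F : LevelSystem Q E}

/-- The two elements whose collapse generates the principal congruence of colour `p`. -/
def std (F : LevelSystem Q E) (p : Q) (k : Bool) : GadgetLattice F := vx (F.d p) p k le_rfl

theorem con_std_iff (p r : Q) :
    con (· ≤ r) (std F p false) (std F p true) ↔ p ≤ r := by
  have gc := F.gc
  have dc := F.dc
  have lo : F.c (F.d p) ≤ r → p ≤ r := fun h => ((F.gc _ _).1 le_rfl).trans h
  simp only [con, std]
  simp [le_def, rel, inner, outer, lev]
  grind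

variable [WellFoundedLT E] {r : GadgetLattice F → GadgetLattice F → Prop} (hr : IsLatCon r)

include hr

theorem down {a b u v : GadgetLattice F} (h : r a b)
    (hv : v ≤ b := by simp [le_def, rel, inner, outer, lev] <;> grind)
    (huv : u ≤ v := by simp [le_def, rel, inner, outer, lev] <;> grind)
    (hw : ∀ w, w ≤ a → w ≤ v → w ≤ u := by intro w; cases w <;>
      simp [le_def, rel, inner, outer, lev] <;> grind) : r u v :=
  hr.down h hv huv hw

theorem up {a b u v : GadgetLattice F} (h : r a b)
    (hu : a ≤ u := by simp [le_def, rel, inner, outer, lev] <;> grind)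
    (huv : u ≤ v := by simp [le_def, rel, inner, outer, lev] <;> grind)
    (hw : ∀ w, b ≤ w → u ≤ w → v ≤ w := by intro w; cases w <;>
      simp [le_def, rel, inner, outer, lev] <;> grind) : r u v :=
  hr.up h hu huv hw

theorem xl_of_vx {e e' : E} {p : Q} (h : F.d p < e) (h' : F.d p ≤ e') (he : e' = e ∨ e' = F.d p)
    (hv : r (vx e' p false h') (vx e' p true h')) : r (xl e p false h) (xl e p true h) :=
  up hr hv

theorem vx_of_xl {e e' : E} {p : Q} (h : F.d p < e) (h' : F.d p ≤ e') (he : e' = e ∨ e' = F.d p)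
    (hv : r (xl e p false h) (xl e p true h)) : r (vx e' p false h') (vx e' p true h') :=
  down hr hv

theorem vx_iff {e : E} {p : Q} (h : F.d p ≤ e) :
    r (vx e p false h) (vx e p true h) ↔ r (std F p false) (std F p true) := by
  rcases h.eq_or_lt with he | he
  · subst he; rfl
  · exact ⟨fun h' => vx_of_xl hr he le_rfl (.inr rfl) (xl_of_vx hr he h (.inl rfl) h'),
      fun h' => vx_of_xl hr he h (.inl rfl) (xl_of_vx hr he le_rfl (.inr rfl) h')⟩

theorem xl_iff {e : E} {p : Q} (h : F.d p < e) :
    r (xl e p false h) (xl e p true h) ↔ r (std F p false) (std F p true) :=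
  ⟨vx_of_xl hr h le_rfl (.inr rfl), xl_of_vx hr h le_rfl (.inr rfl)⟩

theorem mu_left_iff {p q : Q} (h : p < q) (h1 h2) :
    r (mu p q false false h h1) (mu p q true false h h2) ↔
      r (std F p false) (std F p true) := by
  rw [← vx_iff hr (d_mono h.le)]
  exact ⟨fun hm => down hr hm,
    fun hm => up hr hm⟩

theorem mu_right_iff {p q : Q} {a : Bool} (h : p < q) (h1 h2) :
    r (mu p q a false h h1) (mu p q true true h h2) ↔
      r (std F q false) (std F q true) := by
  have := h.ne
  unfold std
  exact ⟨fun hm => down hr hm,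
    fun hm => up hr hm⟩

theorem std_of_le {p q : Q} (h : p ≤ q) (hq : r (std F q false) (std F q true)) :
    r (std F p false) (std F p true) := by
  rcases h.eq_or_lt with rfl | h
  · exact hq
  · rw [← mu_left_iff hr h (by simp) (by simp)]
    exact hr.convex ((mu_right_iff hr h (by simp) (by simp)).2 hq) le_rfl
      (by simp [le_def, rel, inner, outer, lev]) (by simp [le_def, rel, inner, outer, lev])

theorem bot_fr_of_fr_top {e : E} {i j : Option Bool} (hij : i ≠ j) (h : r (fr e i) (top e)) :
    r (bot e) (fr e j) :=
  down hr h

theorem fr_top_of_bot_fr {e : E} {i j : Option Bool} (hij : i ≠ j) (h : r (bot e) (fr e j)) :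
    r (fr e i) (top e) :=
  up hr h

theorem level_of_fr_top {e : E} {i : Option Bool} (h : r (fr e i) (top e)) :
    r (bot e) (top e) := by
  have hjk : ∀ i : Option Bool, ∃ j k, i ≠ j ∧ k ≠ i ∧ k ≠ j := by decide
  obtain ⟨j, k, hj, hk, hkj⟩ := hjk i
  exact hr.1.trans (bot_fr_of_fr_top hr hk (fr_top_of_bot_fr hr hkj (bot_fr_of_fr_top hr hj h))) h

omit hr [WellFoundedLT E] in
theorem le_fr {e : E} {i : Bool} {w : GadgetLattice F} (h : w ≤ fr e (some i)) :
    w = fr e (some i) ∨ w ≤ bot e := by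
  revert h
  cases w <;> simp [le_def, rel, inner, outer, lev] <;> grind

omit hr [WellFoundedLT E] in
theorem fr_le {e : E} {i : Option Bool} {w : GadgetLattice F} (h : fr e i ≤ w) :
    w = fr e i ∨ top e ≤ w := by
  revert h
  cases w <;> simp [le_def, rel, inner, outer, lev] <;> grind

theorem level_of_bot {e : E} {z : GadgetLattice F} (h : r (bot e) z)
    (hz : ¬ z ≤ bot e := by simp [le_def, rel, inner, outer, lev] <;> grind) :
    r (bot e) (top e) := by
  obtain ⟨i, hi⟩ : ∃ i : Bool, ¬ z ≤ fr e (some i) := by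
    by_contra! hc
    have h1 := (le_fr (hc true)).resolve_right hz
    have h2 := (le_fr (hc false)).resolve_right hz
    rw [h1] at h2; cases h2
  refine level_of_fr_top hr (up hr (u := fr e (some i)) h (hw := fun w hzw hw => ?_))
  rcases fr_le hw with rfl | hw
  exacts [absurd hzw hi, hw]

theorem level_of_top {e : E} {z : GadgetLattice F} (h : r z (top e))
    (hz : ¬ top e ≤ z := by simp [le_def, rel, inner, outer, lev] <;> grind) :
    r (bot e) (top e) := by
  obtain ⟨i, hi⟩ : ∃ i : Bool, ¬ fr e (some i) ≤ z := by
    by_contra! hc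
    have h1 := (fr_le (hc true)).resolve_right hz
    have h2 := (fr_le (hc false)).resolve_right hz
    rw [h1] at h2; cases h2
  have hb : r (bot e) (fr e (some i)) := down hr h (hw := fun w hzw hw => by
    rcases le_fr hw with rfl | hw
    exacts [absurd hzw hi, hw])
  exact level_of_fr_top hr (fr_top_of_bot_fr hr (i := none) (by simp) hb)

theorem level_iff (e : E) : r (bot e) (top e) ↔ r (std F (F.c e) false) (std F (F.c e) true) := by
  have dc := F.dc
  rw [← vx_iff hr (dc e).le]
  constructor
  · exact fun h => hr.convex h (by simp [le_def, rel, inner, outer, lev])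
      (by simp [le_def, rel, inner, outer, lev]) (by simp [le_def, rel, inner, outer, lev])
  · intro h
    exact level_of_fr_top hr (i := none) (up hr h)

end GadgetLattice

namespace GadgetLattice

variable {Q E : Type u} [PartialOrder Q] [LinearOrder E] {F : LevelSystem Q E}
  [WellFoundedLT E]

/-- Collapsing `x` and `y` amounts to collapsing the standard pair of some colour. -/
def HasColor (x y : GadgetLattice F) : Prop :=
  ∃ p, ∀ r : GadgetLattice F → GadgetLattice F → Prop, IsLatCon r →
    (r x y ↔ r (std F p false) (std F p true))

theorem hasColor_of_level {x y : GadgetLattice F} (e : E) (hxy : x ≤ y)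
    (h : ∀ r : GadgetLattice F → GadgetLattice F → Prop, IsLatCon r → r x y → r (bot e) (top e))
    (hx : bot e ≤ x := by simp [le_def, rel, inner, outer, lev] <;>
      grind) (hy : y ≤ top e := by simp [le_def, rel, inner, outer, lev] <;> grind) :
    HasColor x y := by
  refine ⟨F.c e, fun r hr => ?_⟩
  rw [← level_iff hr]
  exact ⟨h r hr, fun h' => hr.convex h' hx hxy hy⟩

theorem hasColor_bot (e : E) {y : GadgetLattice F} (h : bot e < y) : HasColor (bot e) y := by
  rcases le_or_gt y.lev e with hl | hl
  · exact hasColor_of_level e h.le (hy := le_top_lev _ hl)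
      fun r hr hr' => level_of_bot hr hr' (not_le_of_gt h)
  obtain ⟨h1, h2⟩ := h
  cases y <;> simp only [lev] at hl
  case top e' => exact hasColor_of_level e' h1 fun r hr hr' => level_of_top hr hr' h2
  case xl e' p k hp =>
    refine hasColor_of_level e' h1 fun r hr h =>
      level_of_bot hr (z := vx e' p false hp.le) (down hr h)
  case xt e' p c hp hc =>
    refine hasColor_of_level e' h1 fun r hr h =>
      level_of_bot hr (z := vx e' p false (hp.trans hc.le)) (down hr h)
  all_goals
    exfalso
    revert h1
    simp only [le_def, rel, inner, outer, lev, or_false, false_or, false_and, and_false, and_true,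
      or_true, true_and, true_or]
    grind

theorem hasColor_top (e : E) {x : GadgetLattice F} (h : x < top e) : HasColor x (top e) := by
  cases x
  case bot => exact hasColor_bot _ h
  all_goals
    obtain ⟨h1, h2⟩ := h
    refine hasColor_of_level e (hx := ?_) h1 fun r hr hr' => level_of_top hr hr' h2
    revert h1
    simp only [le_def, rel, inner, outer, lev, or_false, false_or, false_and, and_false, and_true,
      or_true, true_and, true_or]
    grind

theorem hasColor_xt_of_lev_le {x : GadgetLattice F} {e : E} {p : Q} {c : E} (h hc)
    (hx : x.lev ≤ c) : HasColor x (xt e p c h hc) := by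
  refine hasColor_of_level e (hx := ?_) ?_ fun r hr hr' =>
    level_of_bot hr (z := vx e p false (h.trans hc.le)) (down hr hr' (hw := ?_))
  all_goals revert hx
  · cases x <;>
      simp only [le_def, rel, inner, outer, lev, or_false, false_or, false_and, and_false, and_true,
      or_true, true_and, true_or] <;> grind
  · intro hx w
    revert hx
    cases x <;>
      cases w <;>
      simp only [le_def, rel, inner, outer, lev, or_false, false_or, false_and, and_false, and_true,
      or_true, true_and, true_or] <;> grind
  · cases x <;>
      simp only [le_def, rel, inner, outer, lev, or_false, false_or, false_and, and_false, and_true,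
      or_true, true_and, true_or] <;> grind

theorem hasColor_vx {e : E} {p : Q} {k : Bool} (h : F.d p ≤ e) {y : GadgetLattice F}
    (hy : vx e p k h < y) : HasColor (vx e p k h) y := by
  have dm : ∀ p q : Q, p < q → F.d p ≤ F.d q := fun p q h => d_mono h.le
  have dc := F.dc
  have hy' := hy
  obtain ⟨h1, h2⟩ := hy'
  cases y <;>
    revert h1 <;>
    simp only [le_def, rel, inner, outer, lev, or_false, false_or, false_and, and_false, and_true,
    or_true, true_and, true_or]
  case top => exact fun _ => hasColor_top _ hy
  case vx e' p' k' h' =>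
    rintro ⟨rfl, rfl, hk⟩
    obtain ⟨rfl, rfl⟩ : k = false ∧ k' = true := by
      revert h2; simp only [le_def, rel, inner, outer, lev, or_false, false_or, false_and,
        and_false, and_true, or_true, true_and, true_or]; grind
    exact ⟨p, fun r hr => vx_iff hr h⟩
  case fr e' i =>
    rintro ⟨rfl, rfl, rfl, rfl⟩
    refine hasColor_of_level e hy.le fun r hr hr' =>
      level_of_top hr (z := vx e (F.c e) true h) (up hr hr')
  case mu p' q' a b h' hab =>
    have := h'.ne
    have := dm p' q' h'
    rintro ⟨rfl, ⟨rfl, hk⟩ | ⟨rfl, hk⟩⟩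
    · refine hasColor_of_level (F.d q') hy.le fun r hr hr' =>
        level_of_bot hr (z := vx (F.d q') q' false le_rfl) (down hr hr')
    · refine hasColor_of_level (F.d p) hy.le fun r hr hr' =>
        level_of_bot hr (z := vx (F.d p) p' false this) (down hr hr')
  case xl e' p' k' h' =>
    rintro ⟨rfl, rfl | rfl, hk⟩
    · refine hasColor_of_level e hy.le fun r hr hr' =>
        level_of_bot hr (z := bot (F.d p)) (down hr hr')
    · refine hasColor_of_level e' hy.le fun r hr hr' =>
        level_of_bot hr (z := vx e' p false h'.le) (down hr hr')
  case xt e' p' c h' hc =>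
    rintro (⟨rfl, rfl⟩ | hl)
    · refine hasColor_of_level e hy.le fun r hr hr' =>
        level_of_bot hr (z := bot (F.d p)) (down hr hr')
    · exact hasColor_xt_of_lev_le h' hc hl
  all_goals exact False.elim

theorem hasColor_fr {e : E} {i : Option Bool} {y : GadgetLattice F}
    (hy : fr e i < y) : HasColor (fr e i) y := by
  have hy' := hy
  obtain ⟨h1, h2⟩ := hy'
  cases y <;>
    revert h1 <;>
    simp only [le_def, rel, inner, outer, lev, or_false, false_or, false_and, and_false, and_true,
    or_true, true_and, true_or]
  case top => exact fun _ => hasColor_top _ hy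
  case fr => rintro ⟨rfl, rfl⟩; exact absurd hy (lt_irrefl _)
  case xt => exact fun hl => hasColor_xt_of_lev_le _ _ hl
  all_goals exact False.elim

theorem hasColor_mu {p q : Q} {a b : Bool} (h : p < q) (hab) {y : GadgetLattice F}
    (hy : mu p q a b h hab < y) : HasColor (mu p q a b h hab) y := by
  have hy' := hy
  obtain ⟨h1, h2⟩ := hy'
  cases y <;>
    revert h1 <;>
    simp only [le_def, rel, inner, outer, lev, or_false, false_or, false_and, and_false, and_true,
    or_true, true_and, true_or]
  case top => exact fun _ => hasColor_top _ hy
  case mu p' q' a' b' h' hab' =>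
    rintro ⟨rfl, rfl, ha, hb⟩
    rcases b with _ | _
    · rcases b' with _ | _
      · obtain ⟨rfl, rfl⟩ : a = false ∧ a' = true := by
          revert h2; simp only [le_def, rel, inner, outer, lev, or_false, false_or, false_and,
            and_false, and_true, or_true, true_and, true_or]; grind
        exact ⟨p, fun r hr => mu_left_iff hr h _ _⟩
      · obtain rfl : a' = true := hab' rfl
        exact ⟨q, fun r hr => mu_right_iff hr h _ _⟩
    · revert h2; simp only [le_def, rel, inner, outer, lev, or_false, false_or, false_and,
        and_false, and_true, or_true, true_and, true_or]; grind
  case xt => exact fun hl => hasColor_xt_of_lev_le _ _ hl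
  all_goals exact False.elim

theorem hasColor_xl {e : E} {p : Q} {k : Bool} (h : F.d p < e) {y : GadgetLattice F}
    (hy : xl e p k h < y) : HasColor (xl e p k h) y := by
  have hy' := hy
  obtain ⟨h1, h2⟩ := hy'
  cases y <;>
    revert h1 <;>
    simp only [le_def, rel, inner, outer, lev, or_false, false_or, false_and, and_false, and_true,
    or_true, true_and, true_or]
  case top => exact fun _ => hasColor_top _ hy
  case xl e' p' k' h' =>
    rintro ⟨rfl, rfl, hk⟩
    obtain ⟨rfl, rfl⟩ : k = false ∧ k' = true := by
      revert h2; simp only [le_def, rel, inner, outer, lev, or_false, false_or, false_and,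
        and_false, and_true, or_true, true_and, true_or]; grind
    exact ⟨p, fun r hr => xl_iff hr h⟩
  case xt e' p' c h' hc =>
    rintro (⟨rfl, rfl⟩ | hl)
    · refine ⟨F.c c, fun r hr => ?_⟩
      rw [← level_iff hr]
      exact ⟨fun hr' => level_of_top hr (z := vx (F.d p) p k le_rfl) (down hr hr'),
        fun hr' => up hr hr' (huv := hy.le)⟩
    · exact hasColor_xt_of_lev_le h' hc hl
  all_goals exact False.elim

theorem hasColor_xt {e : E} {p : Q} {c : E} (h : F.d p ≤ c) (hc : c < e) {y : GadgetLattice F}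
    (hy : xt e p c h hc < y) : HasColor (xt e p c h hc) y := by
  have hy' := hy
  obtain ⟨h1, h2⟩ := hy'
  cases y <;>
    revert h1 <;>
    simp only [le_def, rel, inner, outer, lev, or_false, false_or, false_and, and_false, and_true,
    or_true, true_and, true_or]
  case top => exact fun _ => hasColor_top _ hy
  case xt e' p' c' h' hc' =>
    rintro (⟨rfl, rfl, hl⟩ | hl)
    · have hlt : c < c' := by
        revert h2; simp only [le_def, rel, inner, outer, lev, or_false, false_or, false_and,
          and_false, and_true, or_true, true_and, true_or]; grind
      refine ⟨F.c c', fun r hr => ?_⟩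
      rw [← level_iff hr]
      exact ⟨fun hr' => level_of_top hr (z := top c) (down hr hr'),
        fun hr' => up hr hr' (huv := hy.le)⟩
    · exact hasColor_xt_of_lev_le h' hc' hl
  all_goals exact False.elim

theorem hasColor {x y : GadgetLattice F} (h : x < y) : HasColor x y := by
  cases x
  case bot => exact hasColor_bot _ h
  case vx => exact hasColor_vx _ h
  case fr => exact hasColor_fr h
  case mu => exact hasColor_mu _ _ h
  case xl => exact hasColor_xl _ h
  case xt => exact hasColor_xt _ _ h
  case top e =>
    have h' := h
    obtain ⟨h1, h2⟩ := h'
    cases y <;>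
      revert h1 <;>
      simp only [le_def, rel, inner, outer, lev, or_false, false_or, false_and, and_false, and_true,
      or_true, true_and, true_or]
    case top => exact fun _ => hasColor_top _ h
    case xt => exact fun hl => hasColor_xt_of_lev_le _ _ hl
    all_goals exact False.elim

end GadgetLattice

/-- Every chain has a cofinal well-ordered subset. -/
theorem exists_cofinal_wellFoundedLT {α : Type*} [PartialOrder α] {C : Set α}
    (hC : IsChain (· ≤ ·) C) :
    ∃ D ⊆ C, (∀ x ∈ C, ∃ y ∈ D, x ≤ y) ∧ WellFoundedLT D := by
  refine ⟨{a | a ∈ C ∧ ∀ b ∈ C, WellOrderingRel b a → b < a}, fun a h => h.1, fun x hx => ?_, ?_⟩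
  · obtain ⟨y, hy, hmin⟩ := (IsWellFounded.wf (r := WellOrderingRel (α := α))).has_min
      {y | y ∈ C ∧ x ≤ y} ⟨x, hx, le_rfl⟩
    refine ⟨y, ⟨hy.1, fun b hb hby => ?_⟩, hy.2⟩
    have hxb : ¬ x ≤ b := fun h => hmin b ⟨hb, h⟩ hby
    have hbx : b ≤ x := (hC.total hb hx).resolve_right hxb
    exact (lt_of_le_not_ge hbx hxb).trans_le hy.2
  · refine ⟨Subrelation.wf (r := InvImage WellOrderingRel Subtype.val) (fun {a b} hab => ?_)
      (InvImage.wf _ (IsWellFounded.wf (r := WellOrderingRel (α := α))))⟩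
    rcases trichotomous_of WellOrderingRel a.1 b.1 with h | h | h
    · exact h
    · exact absurd (Subtype.ext h) hab.ne
    · exact absurd (a.2.2 _ b.2.1 h) (lt_asymm hab)

/-- A chain is linearly ordered as a subtype. -/
noncomputable abbrev IsChain.subtypeLinearOrder {α : Type*} [PartialOrder α] {C : Set α}
    (hC : IsChain (· ≤ ·) C) : LinearOrder C :=
  { (inferInstance : PartialOrder C) with
    le_total := fun a b => hC.total a.2 b.2
    toDecidableLE := Classical.decRel _ }

theorem cg_self {L : Type*} [Lattice L] (a b : L) : cg a b a b := fun _ _ h => h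

theorem cg_le_cg_iff {L : Type*} [Lattice L] {a b c d : L} :
    cg a b ≤ cg c d ↔ ∀ r : L → L → Prop, IsLatCon r → r c d → r a b :=
  ⟨fun h => h a b (cg_self a b), fun h _ _ hxy r hr hcd => hxy r hr (h r hr hcd)⟩

theorem IsLatCon.inf_sup_iff {L : Type*} [Lattice L] {r : L → L → Prop} (hr : IsLatCon r)
    (a b : L) : r (a ⊓ b) (a ⊔ b) ↔ r a b := by
  refine ⟨fun h => ?_, fun h => ?_⟩
  · exact hr.1.trans (hr.1.symm (hr.convex h le_rfl inf_le_left le_sup_left))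
      (hr.convex h le_rfl inf_le_right le_sup_right)
  · have h1 := hr.2.1 _ _ _ _ h (hr.1.refl b)
    have h2 := hr.2.2 _ _ _ _ h (hr.1.refl b)
    rw [inf_idem] at h1
    rw [sup_idem] at h2
    exact hr.1.trans h1 (hr.1.symm h2)

theorem isLatCon_eq (L : Type*) [Lattice L] : IsLatCon (Eq : L → L → Prop) :=
  ⟨eq_equivalence, fun _ _ _ _ h h' => by rw [h, h'], fun _ _ _ _ h h' => by rw [h, h']⟩

theorem nonempty_orderIso_princ {P L : Type*} [PartialOrder P] [Lattice L] (s : P → L × L)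
    (hle : ∀ x y, cg (s x).1 (s x).2 ≤ cg (s y).1 (s y).2 ↔ x ≤ y)
    (hs : ∀ a b : L, a ≤ b → ∃ x, ∀ r : L → L → Prop, IsLatCon r →
      (r a b ↔ r (s x).1 (s x).2)) : Nonempty (P ≃o Princ L) := by
  let f : P ↪o Princ L := OrderEmbedding.ofMapLEIff
    (fun x => ⟨cg (s x).1 (s x).2, _, _, rfl⟩) hle
  refine ⟨RelIso.ofSurjective f ?_⟩
  rintro ⟨θ, a, b, rfl⟩
  obtain ⟨x, hx⟩ := hs (a ⊓ b) (a ⊔ b) inf_le_sup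
  refine ⟨x, Subtype.ext (le_antisymm (cg_le_cg_iff.2 fun r hr h => ?_)
    (cg_le_cg_iff.2 fun r hr h => ?_))⟩
  · exact (hx r hr).1 ((hr.inf_sup_iff a b).2 h)
  · exact (hr.inf_sup_iff a b).1 ((hx r hr).2 h)

theorem exists_levelSystem {Q : Type u} [PartialOrder Q] {C : Set Q} (hC : IsChain (· ≤ ·) C)
    (hcof : ∀ x, ∃ y ∈ C, x ≤ y) :
    ∃ (E : Type u) (_ : LinearOrder E) (_ : WellFoundedLT E), Nonempty (LevelSystem Q E) := by
  obtain ⟨D, hDC, hD, hwf⟩ := exists_cofinal_wellFoundedLT hC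
  have hne : ∀ p : Q, {e : D | p ≤ e.1}.Nonempty := fun p => by
    obtain ⟨y, hy, hpy⟩ := hcof p
    obtain ⟨e, he, hye⟩ := hD y hy
    exact ⟨⟨e, he⟩, hpy.trans hye⟩
  letI : LinearOrder D := (hC.mono hDC).subtypeLinearOrder
  have hmin : ∀ p (e : D), p ≤ e.1 → hwf.wf.min _ (hne p) ≤ e := fun p e h =>
    not_lt.1 (hwf.wf.not_lt_min _ h)
  have hgc : ∀ p (e : D), hwf.wf.min _ (hne p) ≤ e ↔ p ≤ e.1 := fun p e =>
    ⟨fun h => le_trans (hwf.wf.min_mem _ (hne p)) h, hmin p e⟩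
  exact ⟨D, inferInstance, hwf, ⟨⟨fun p => hwf.wf.min _ (hne p), Subtype.val, hgc,
    fun e => le_antisymm (hmin _ _ le_rfl) (hwf.wf.min_mem _ (hne e.1))⟩⟩⟩

theorem exists_lattice_of_subsingleton {P : Type u} [PartialOrder P] (z : P) (hz : ∀ x, x = z) :
    ∃ (L : Type u) (_ : Lattice L), Nonempty (P ≃o Princ L) :=
  ⟨PUnit, inferInstance, nonempty_orderIso_princ (fun _ => (⟨⟩, ⟨⟩))
    (fun x y => ⟨fun _ => by rw [hz x, hz y], fun _ => le_rfl⟩) fun _ _ _ => ⟨z,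
      fun _ _ => Iff.rfl⟩⟩

open GadgetLattice in
theorem exists_lattice_of_levelSystem {P E : Type u} [PartialOrder P] {z : P} (hz : ∀ x, z ≤ x)
    [LinearOrder E] [WellFoundedLT E] (F : LevelSystem {x : P // x ≠ z} E)
    (q₀ : {x : P // x ≠ z}) :
    ∃ (L : Type u) (_ : Lattice L), Nonempty (P ≃o Princ L) := by
  classical
  have hne : ∀ p, std F p false ≠ std F p true := fun p h => by
    injection h; contradiction
  let s : P → GadgetLattice F × GadgetLattice F := fun x =>
    if h : x = z then (std F q₀ false, std F q₀ false) else (std F ⟨x, h⟩ false, std F ⟨x, h⟩ true)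
  have sz : s z = (std F q₀ false, std F q₀ false) := dif_pos rfl
  have sp : ∀ p : {x : P // x ≠ z}, s p = (std F p false, std F p true) := fun p => dif_neg p.2
  refine ⟨GadgetLattice F, inferInstance, nonempty_orderIso_princ s (fun x y => ?_) ?_⟩
  · rw [cg_le_cg_iff]
    by_cases hx : x = z
    · subst hx
      rw [sz]
      exact ⟨fun _ => hz y, fun _ r hr _ => hr.1.refl _⟩
    lift x to {x : P // x ≠ z} using hx
    rw [sp]
    by_cases hy : y = z
    · subst hy
      rw [sz]
      exact ⟨fun h => absurd (h _ (isLatCon_eq _) rfl) (hne x),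
        fun h => absurd (le_antisymm h (hz _)) x.2⟩
    lift y to {x : P // x ≠ z} using hy
    rw [sp]
    constructor
    · intro h
      have hG : ∀ p q : {x : P // x ≠ z}, p ≤ q → q ≤ y → p ≤ y := fun p q => le_trans
      exact (con_std_iff x y).1 (h _ (isLatCon_con hG) ((con_std_iff y y).2 le_rfl))
    · exact fun h r hr => std_of_le hr h
  · intro a b hab
    rcases hab.eq_or_lt with rfl | hlt
    · exact ⟨z, fun r hr => by rw [sz]; exact ⟨fun _ => hr.1.refl _, fun _ => hr.1.refl _⟩⟩
    · obtain ⟨p, hp⟩ := hasColor hlt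
      exact ⟨p, fun r hr => by rw [sp]; exact hp r hr⟩

/-- If an ordered set `P` with least element is the union of a chain of principal order
ideals, then `P ≅ Princ L` for some lattice `L`. -/
theorem stmt1 {P : Type u} [PartialOrder P]
    (h0 : ∃ z : P, ∀ x : P, z ≤ x)
    (hch : ∃ S : Set (Set P), (∀ I ∈ S, ∃ c : P, I = Set.Iic c) ∧
      IsChain (· ⊆ ·) S ∧ ⋃₀ S = Set.univ) :
    ∃ (L : Type u) (_ : Lattice L), Nonempty (P ≃o Princ L) := by
  obtain ⟨z, hz⟩ := h0
  obtain ⟨S, hS, hchain, hun⟩ := hch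
  by_cases hP : ∀ x, x = z
  · exact exists_lattice_of_subsingleton z hP
  obtain ⟨q₀, hq₀⟩ := not_forall.1 hP
  let C : Set {x : P // x ≠ z} := {c | Set.Iic c.1 ∈ S}
  have hC : IsChain (· ≤ ·) C := fun a ha b hb _ =>
    (hchain.total ha hb).imp (fun h => (Set.Iic_subset_Iic (a := a.1) (b := b.1)).1 h)
      fun h => (Set.Iic_subset_Iic (a := b.1) (b := a.1)).1 h
  have hcof : ∀ x, ∃ y ∈ C, x ≤ y := fun x => by
    obtain ⟨I, hI, hx⟩ : x.1 ∈ ⋃₀ S := hun ▸ Set.mem_univ _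
    obtain ⟨c, rfl⟩ := hS I hI
    exact ⟨⟨c, fun h => x.2 (le_antisymm ((Set.mem_Iic.1 hx).trans_eq h) (hz _))⟩, hI, hx⟩
  obtain ⟨E, _, _, ⟨F⟩⟩ := exists_levelSystem hC hcof
  exact exists_lattice_of_levelSystem hz F ⟨q₀, hq₀⟩
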